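/- (Necessity of the Wiener condition for positivity.) Assume the Jellium condition, and suppose the Wiener condition fails, i.e. there exist θ ∈ Γ*_N \ Γ*_1 and a nonzero vector v ∈ ℝ³ with Σ(θ)v = 0. Then for every α ∈ ℝ and r ∈ ℝ³ there exists a map κ : Γ_N → ℝ³ which is not identically zero, with ∑_{n∈Γ_N} κ(n) = 0 and B(0,κ,0) = 0. In particular the quadratic form B vanishes on a nonzero vector satisfying the orthogonality constraints ∫_{T_N}φ dx = 0, ∑_n κ(n) = 0. -/

import Mathlib

noncomputable section

namespace SPN

open MeasureTheory Finset
open scoped Real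

/-- Points of `ℝ³`. -/
abbrev V3 : Type := Fin 3 → ℝ

/-- Euclidean dot product on `ℝ³`. -/
def dotP (v w : V3) : ℝ := ∑ i, v i * w i

/-- Squared Euclidean norm on `ℝ³`. -/
def nsqV (v : V3) : ℝ := ∑ i, v i ^ 2

/-- The fundamental cube `[0,N)³` of the torus `T_N = ℝ³/(N·ℤ³)`. -/
def cubeN (N : ℕ) : Set V3 := {x | ∀ i, x i ∈ Set.Ico (0 : ℝ) (N : ℝ)}

/-- `N·ℤ³`-periodicity of a function on `ℝ³`. -/
def IsPerN {α : Type*} (N : ℕ) (f : V3 → α) : Prop :=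
  ∀ (x : V3) (k : Fin 3 → ℤ), f (x + fun i => (N : ℝ) * (k i : ℝ)) = f x

/-- Index set for `Γ_N = {0,…,N−1}³`. -/
abbrev GammaIdx (N : ℕ) : Type := Fin 3 → Fin N

/-- The lattice point of `Γ_N` associated to an index. -/
def embG {N : ℕ} (n : GammaIdx N) : V3 := fun i => ((n i : ℕ) : ℝ)

/-- Fourier coefficient `f̂(ξ) = ∫_{T_N} e^{iξ·x} f(x) dx`. -/
def fCoeff (N : ℕ) (f : V3 → ℂ) (ξ : V3) : ℂ :=
  ∫ x in cubeN N, Complex.exp (Complex.I * ((dotP ξ x : ℝ) : ℂ)) * f x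

/-- Fourier coefficient of a real-valued function. -/
def fCoeffR (N : ℕ) (f : V3 → ℝ) (ξ : V3) : ℂ :=
  fCoeff N (fun x => ((f x : ℝ) : ℂ)) ξ

/-- The point `(2π/N)·k` of the dual lattice `Γ*_N`. -/
def xiN (N : ℕ) (k : Fin 3 → ℤ) : V3 := fun i => (2 * π / (N : ℝ)) * (k i : ℝ)

/-- The Jellium condition: `σ̂(ξ) = 0` for all `ξ ∈ Γ*_1 \ {0}`. -/
def JelliumCond (N : ℕ) (σ : V3 → ℝ) : Prop :=
  ∀ k : Fin 3 → ℤ, k ≠ 0 → fCoeffR N σ (fun i => 2 * π * (k i : ℝ)) = 0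

/-- `(2π/N)·k ∈ Γ*_1`, i.e. every coordinate of `k` is divisible by `N`. -/
def inGamma1 (N : ℕ) (k : Fin 3 → ℤ) : Prop := ∀ i, (N : ℤ) ∣ k i

/-- `|∇φ(x)|²` for a complex-valued function. -/
def gradSq (φ : V3 → ℂ) (x : V3) : ℝ :=
  ∑ i, Complex.normSq (fderiv ℝ φ x (Pi.single i 1))

/-- Gradient of a real-valued function on `ℝ³`. -/
def gradV (f : V3 → ℝ) (x : V3) : V3 := fun i => fderiv ℝ f x (Pi.single i 1)

/-- Total charge density `ρ(x) = ∑_n σ(x−n−q(n)) − e|ψ(x)|²`. -/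
def rhoT (N : ℕ) (σ : V3 → ℝ) (e : ℝ) (ψ : V3 → ℂ) (q : GammaIdx N → V3) (x : V3) : ℝ :=
  (∑ n : GammaIdx N, σ (x - embG n - q n)) - e * Complex.normSq (ψ x)

/-- `∑_{ξ∈Γ*_N\{0}} |f̂(ξ)|²/|ξ|²`. -/
def dualSum (N : ℕ) (f : V3 → ℝ) : ℝ :=
  ∑' k : Fin 3 → ℤ, if k = 0 then 0 else
    Complex.normSq (fCoeffR N f (xiN N k)) / nsqV (xiN N k)

/-- The energy functional `E(ψ,q,p)`. -/
def energyE (N : ℕ) (σ : V3 → ℝ) (e M : ℝ) (ψ : V3 → ℂ) (q p : GammaIdx N → V3) : ℝ :=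
  (1 / 2) * (∫ x in cubeN N, gradSq ψ x)
    + (2 * (N : ℝ) ^ 3)⁻¹ * dualSum N (rhoT N σ e ψ q)
    + (2 * M)⁻¹ * ∑ n : GammaIdx N, nsqV (p n)

/-- The matrix `Σ(θ) = ∑_{m∈ℤ³} (ξξᵀ/|ξ|²)|σ̂(ξ)|²`, `ξ = θ + 2πm`. -/
def SigMat (N : ℕ) (σ : V3 → ℝ) (θ : V3) : Matrix (Fin 3) (Fin 3) ℝ :=
  Matrix.of fun a b => ∑' m : Fin 3 → ℤ,
    ((θ a + 2 * π * (m a : ℝ)) * (θ b + 2 * π * (m b : ℝ))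
        / nsqV (fun i => θ i + 2 * π * (m i : ℝ)))
      * Complex.normSq (fCoeffR N σ (fun i => θ i + 2 * π * (m i : ℝ)))

/-- The Wiener condition: `Σ(θ)` is positive definite for all `θ ∈ Γ*_N \ Γ*_1`. -/
def WienerCond (N : ℕ) (σ : V3 → ℝ) : Prop :=
  ∀ k : Fin 3 → ℤ, ¬ inGamma1 N k → (SigMat N σ (xiN N k)).PosDef

/-- First-order ionic density `σ⁽¹⁾(x) = −∑_n κ(n)·∇σ(x−n−r)`. -/
def sigma1F (N : ℕ) (σ : V3 → ℝ) (r : V3) (κ : GammaIdx N → V3) (x : V3) : ℝ :=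
  - ∑ n : GammaIdx N, dotP (κ n) (gradV σ (x - embG n - r))

/-- First-order charge density `ρ⁽¹⁾(x) = σ⁽¹⁾(x) − 2e√Z·Re(e^{−iα}φ(x))`. -/
def rho1F (N : ℕ) (σ : V3 → ℝ) (e Z α : ℝ) (r : V3) (κ : GammaIdx N → V3)
    (φ : V3 → ℂ) (x : V3) : ℝ :=
  sigma1F N σ r κ x - 2 * e * Real.sqrt Z * (Complex.exp (-Complex.I * (α : ℂ)) * φ x).re

/-- The quadratic form `B(φ,κ,p)` (half of the energy Hessian). -/
def BformQ (N : ℕ) (σ : V3 → ℝ) (e Z M α : ℝ) (r : V3)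
    (φ : V3 → ℂ) (κ p : GammaIdx N → V3) : ℝ :=
  (1 / 2) * (∫ x in cubeN N, gradSq φ x)
    + (2 * (N : ℝ) ^ 3)⁻¹ * dualSum N (rho1F N σ e Z α r κ φ)
    + (2 * M)⁻¹ * ∑ n : GammaIdx N, nsqV (p n)

/-- Second-order charge density `ρ⁽²⁾`. -/
def rho2F (N : ℕ) (σ : V3 → ℝ) (e : ℝ) (r : V3) (κ : GammaIdx N → V3)
    (φ : V3 → ℂ) (x : V3) : ℝ :=
  (∑ n : GammaIdx N,
      (σ (x - embG n - r - κ n) - σ (x - embG n - r)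
        + dotP (κ n) (gradV σ (x - embG n - r))))
    - e * Complex.normSq (φ x)

/-- The pairing `(f, Gg) = N⁻³ ∑_{ξ∈Γ*_N\{0}} Re(f̂(ξ)·conj(ĝ(ξ)))/|ξ|²`. -/
def GPair (N : ℕ) (f g : V3 → ℝ) : ℝ :=
  ((N : ℝ) ^ 3)⁻¹ * ∑' k : Fin 3 → ℤ, if k = 0 then 0 else
    (fCoeffR N f (xiN N k) * (starRingEnd ℂ) (fCoeffR N g (xiN N k))).re / nsqV (xiN N k)

/-- The distance to the solitary manifold of ground states. -/
def distS (N : ℕ) (Z : ℝ) (ψ : V3 → ℂ) (q p : GammaIdx N → V3) : ℝ :=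
  ⨅ (α : ℝ) (r : V3),
    (Real.sqrt (∫ x in cubeN N,
        (Complex.normSq (ψ x - Complex.exp (Complex.I * (α : ℂ)) * ((Real.sqrt Z : ℝ) : ℂ))
          + gradSq ψ x))
      + Real.sqrt (∑ n : GammaIdx N, ⨅ k : Fin 3 → ℤ,
          nsqV (fun i => q n i - r i - (N : ℝ) * (k i : ℝ)))
      + Real.sqrt (∑ n : GammaIdx N, nsqV (p n)))

/-- The discrete Fourier transform `κ̂(θ) ∈ ℂ³` of `κ : Γ_N → ℝ³`. -/
def hatK (N : ℕ) (κ : GammaIdx N → V3) (θ : V3) (a : Fin 3) : ℂ :=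
  ∑ n : GammaIdx N, Complex.exp (Complex.I * ((dotP θ (embG n) : ℝ) : ℂ)) * ((κ n a : ℝ) : ℂ)

/-- Laplacian of a complex-valued function on `ℝ³`. -/
def lapC (f : V3 → ℂ) (x : V3) : ℂ :=
  ∑ i, fderiv ℝ (fun y => fderiv ℝ f y (Pi.single i 1)) x (Pi.single i 1)

/-- Laplacian of a real-valued function on `ℝ³`. -/
def lapR (f : V3 → ℝ) (x : V3) : ℝ :=
  ∑ i, fderiv ℝ (fun y => fderiv ℝ f y (Pi.single i 1)) x (Pi.single i 1)

/-- A classical solution of the Schrödinger–Poisson–Newton system on `ℝ`. -/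
structure IsSPN (N : ℕ) (σ : V3 → ℝ) (e M : ℝ)
    (ψ : V3 → ℝ → ℂ) (Φ : V3 → ℝ → ℝ) (q : ℝ → GammaIdx N → V3) : Prop where
  per_psi : ∀ t : ℝ, IsPerN N (fun x => ψ x t)
  per_Phi : ∀ t : ℝ, IsPerN N (fun x => Φ x t)
  regx_psi : ∀ t : ℝ, ContDiff ℝ 2 (fun x => ψ x t)
  regt_psi : ∀ x : V3, ContDiff ℝ 1 (fun t => ψ x t)
  regx_Phi : ∀ t : ℝ, ContDiff ℝ 2 (fun x => Φ x t)
  regt_Phi : ∀ x : V3, ContDiff ℝ 1 (fun t => Φ x t)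
  reg_q : ContDiff ℝ 2 q
  schrodinger : ∀ (x : V3) (t : ℝ),
    Complex.I * deriv (fun s => ψ x s) t =
      -(1 / 2 : ℂ) * lapC (fun y => ψ y t) x - ((e : ℝ) : ℂ) * ((Φ x t : ℝ) : ℂ) * ψ x t
  poisson : ∀ (x : V3) (t : ℝ),
    - lapR (fun y => Φ y t) x =
      (∑ n : GammaIdx N, σ (x - embG n - q t n)) - e * Complex.normSq (ψ x t)
  newton : ∀ (n : GammaIdx N) (t : ℝ) (i : Fin 3),
    M * deriv (fun s => deriv (fun u => q u n i) s) t =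
      - ∫ x in cubeN N, fderiv ℝ (fun y => Φ y t) x (Pi.single i 1) * σ (x - embG n - q t n)

/-- The character `x ↦ e^{iξ·x}`. -/
def ec (ξ x : V3) : ℂ := Complex.exp (Complex.I * ((dotP ξ x : ℝ) : ℂ))

lemma dotP_add_right (ξ x y : V3) : dotP ξ (x + y) = dotP ξ x + dotP ξ y := by
  simp [dotP, mul_add, Finset.sum_add_distrib]

lemma dotP_add_left (ξ η x : V3) : dotP (ξ + η) x = dotP ξ x + dotP η x := by
  simp [dotP, add_mul, Finset.sum_add_distrib]

lemma dotP_neg_left (ξ x : V3) : dotP (-ξ) x = - dotP ξ x := by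
  simp [dotP]

lemma ec_add_right (ξ x y : V3) : ec ξ (x + y) = ec ξ x * ec ξ y := by
  unfold ec
  rw [dotP_add_right, ← Complex.exp_add]
  push_cast
  ring_nf

lemma ec_add_left (ξ η x : V3) : ec (ξ + η) x = ec ξ x * ec η x := by
  unfold ec
  rw [dotP_add_left, ← Complex.exp_add]
  push_cast
  ring_nf

lemma ec_neg_left (ξ x : V3) : ec (-ξ) x = (starRingEnd ℂ) (ec ξ x) := by
  unfold ec
  rw [dotP_neg_left, ← Complex.exp_conj]
  simp

lemma ec_zero_left (x : V3) : ec 0 x = 1 := by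
  simp [ec, dotP]

lemma ec_int (N : ℕ) (hN : 0 < N) (k m : Fin 3 → ℤ) :
    ec (xiN N k) (fun i => (N : ℝ) * (m i : ℝ)) = 1 := by
  unfold ec
  rw [Complex.exp_eq_one_iff]
  refine ⟨∑ i, k i * m i, ?_⟩
  have hN' : (N : ℂ) ≠ 0 := by exact_mod_cast hN.ne'
  simp only [dotP, xiN]
  push_cast
  rw [Finset.mul_sum, Finset.sum_mul]
  refine Finset.sum_congr rfl fun i _ => ?_
  field_simp

lemma ec_per (N : ℕ) (hN : 0 < N) (k : Fin 3 → ℤ) : IsPerN N (ec (xiN N k)) := by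
  intro x m
  rw [ec_add_right, ec_int N hN, mul_one]

lemma ec_contDiff (ξ : V3) : ContDiff ℝ 2 (ec ξ) := by
  unfold ec dotP
  have h : ContDiff ℝ 2 (fun x : V3 => ∑ i, ξ i * x i) := by fun_prop
  have h2 : ContDiff ℝ 2 (fun x : V3 => ((∑ i, ξ i * x i : ℝ) : ℂ)) :=
    Complex.ofRealCLM.contDiff.comp h
  exact (contDiff_const.mul h2).cexp

lemma ec_cont (ξ : V3) : Continuous (ec ξ) := (ec_contDiff ξ).continuous

lemma xiN_add (N : ℕ) (k l : Fin 3 → ℤ) : xiN N (k + l) = xiN N k + xiN N l := by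
  ext i; simp [xiN, mul_add]

lemma xiN_neg (N : ℕ) (k : Fin 3 → ℤ) : xiN N (-k) = - xiN N k := by
  ext i; simp [xiN]

lemma xiN_zero (N : ℕ) : xiN N 0 = 0 := by
  ext i; simp [xiN]

lemma cubeN_eq (N : ℕ) :
    cubeN N = Set.univ.pi fun _ : Fin 3 => Set.Ico (0 : ℝ) (N : ℝ) := by
  ext x; simp [cubeN]

lemma cubeN_meas (N : ℕ) : MeasurableSet (cubeN N) := by
  rw [cubeN_eq]; exact MeasurableSet.univ_pi fun _ => measurableSet_Ico

lemma cubeN_ae (N : ℕ) :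
    cubeN N =ᵐ[volume] Set.Icc (0 : V3) (fun _ => (N : ℝ)) := by
  rw [cubeN_eq]
  exact Measure.univ_pi_Ico_ae_eq_Icc

lemma cubeN_sub (N : ℕ) : cubeN N ⊆ Set.Icc (0 : V3) (fun _ => (N : ℝ)) := by
  intro x hx
  exact ⟨fun i => (hx i).1, fun i => (hx i).2.le⟩

lemma cont_intOn {E : Type*} [NormedAddCommGroup E] (N : ℕ) (f : V3 → E) (hf : Continuous f) :
    IntegrableOn f (cubeN N) volume :=
  (hf.continuousOn.integrableOn_compact isCompact_Icc).mono_set (cubeN_sub N)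

lemma cubeN_vol (N : ℕ) : volume.real (cubeN N) = (N : ℝ) ^ 3 := by
  rw [cubeN_eq, Measure.real, Real.volume_pi_Ico_toReal]
  · simp
  · intro i; simp

lemma cubeN_fin (N : ℕ) : volume (cubeN N) < ⊤ :=
  (measure_mono (cubeN_sub N)).trans_lt isCompact_Icc.measure_lt_top

/-- The basis `N·e_i` of `ℝ³`. -/
def bN (N : ℕ) (hN : 0 < N) : Module.Basis (Fin 3) ℝ V3 :=
  (Pi.basisFun ℝ (Fin 3)).isUnitSMul (w := fun _ => (N : ℝ))
    (fun _ => IsUnit.mk0 _ (by exact_mod_cast hN.ne'))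

lemma bN_repr (N : ℕ) (hN : 0 < N) (x : V3) (i : Fin 3) :
    (bN N hN).repr x i = (N : ℝ)⁻¹ * x i := by
  have hN' : (N : ℝ) ≠ 0 := by exact_mod_cast hN.ne'
  rw [bN, Module.Basis.repr_isUnitSMul]
  simp [Units.smul_def]

lemma bN_fund (N : ℕ) (hN : 0 < N) : ZSpan.fundamentalDomain (bN N hN) = cubeN N := by
  have hN' : (0 : ℝ) < N := by exact_mod_cast hN
  ext x
  simp only [ZSpan.mem_fundamentalDomain, bN_repr, cubeN, Set.mem_ofPred_eq, Set.mem_Ico]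
  refine forall_congr' fun i => ?_
  rw [inv_mul_eq_div, div_lt_one hN', div_nonneg_iff]
  constructor
  · rintro ⟨h1, h2⟩
    refine ⟨?_, h2⟩
    rcases h1 with h | h
    · exact h.1
    · linarith [h.2]
  · rintro ⟨h1, h2⟩
    exact ⟨Or.inl ⟨h1, hN'.le⟩, h2⟩

lemma int_shift {E : Type*} [NormedAddCommGroup E] [NormedSpace ℝ E] (N : ℕ) (hN : 0 < N)
    (f : V3 → E) (hf : IsPerN N f) (a : V3) :
    ∫ x in cubeN N, f (a + x) = ∫ x in cubeN N, f x := by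
  have hN' : (N : ℝ) ≠ 0 := by exact_mod_cast hN.ne'
  have hF := ZSpan.isAddFundamentalDomain (bN N hN) volume
  rw [bN_fund] at hF
  have hG := hF.vadd_of_comm a
  have h1 := (measurePreserving_add_left (volume : Measure V3) a).setIntegral_image_emb
    (measurableEmbedding_addLeft a) f (cubeN N)
  rw [← h1]
  have : VAddInvariantMeasure (Submodule.span ℤ (Set.range (bN N hN))) V3 volume :=
    ⟨fun c s _ => measure_preimage_add volume (c : V3) s⟩
  refine hG.setIntegral_eq hF ?_
  rintro ⟨g, hg⟩ x
  have hg' := ((bN N hN).mem_span_iff_repr_mem ℤ g).1 hg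
  choose k hk using hg'
  have : g = fun i => (N : ℝ) * (k i : ℝ) := by
    ext i
    have := hk i
    rw [bN_repr] at this
    simp only [algebraMap_int_eq, eq_intCast] at this
    rw [this]; field_simp
  have h2 : (⟨g, hg⟩ : Submodule.span ℤ (Set.range (bN N hN))) +ᵥ x = x + fun i => (N : ℝ) * (k i : ℝ) := by
    rw [← this, add_comm]; rfl
  rw [h2, hf]

lemma ec_integral (N : ℕ) (hN : 0 < N) (k : Fin 3 → ℤ) :
    ∫ x in cubeN N, ec (xiN N k) x = if k = 0 then (N : ℂ) ^ 3 else 0 := by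
  split_ifs with h
  · subst h
    simp [xiN_zero, ec_zero_left, cubeN_vol]
  · obtain ⟨i, hi⟩ := Function.ne_iff.1 h
    simp only [Pi.zero_apply] at hi
    have hN' : (N : ℝ) ≠ 0 := by exact_mod_cast hN.ne'
    have hk' : (k i : ℝ) ≠ 0 := by exact_mod_cast hi
    have h1 := int_shift N hN _ (ec_per N hN k) (Pi.single i ((N : ℝ) / (2 * k i)))
    simp only [ec_add_right] at h1
    rw [integral_const_mul] at h1
    have h2 : ec (xiN N k) (Pi.single i ((N : ℝ) / (2 * k i))) = -1 := by
      have : dotP (xiN N k) (Pi.single i ((N : ℝ) / (2 * k i))) = π := by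
        simp [dotP, Pi.single_apply, xiN]
        field_simp
      rw [ec, this, mul_comm, Complex.exp_pi_mul_I]
    rw [h2] at h1
    have h3 : (2 : ℂ) * ∫ x in cubeN N, ec (xiN N k) x = 0 := by linear_combination -h1
    simpa using h3

lemma int_deriv_zero (N : ℕ) (g : V3 → ℂ) (hg : ContDiff ℝ 1 g) (hp : IsPerN N g)
    (i : Fin 3) : ∫ x in cubeN N, fderiv ℝ g x (Pi.single i 1) = 0 := by
  rw [setIntegral_congr_set (cubeN_ae N)]
  have hd : Continuous fun x => fderiv ℝ g x (Pi.single i 1) :=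
    (hg.continuous_fderiv one_ne_zero).clm_apply continuous_const
  have key := integral_divergence_of_hasFDerivAt_off_countable (E := ℂ) (n := 2)
    (0 : V3) (fun _ => (N : ℝ)) (fun i => by simp)
    (fun x => Pi.single i (g x))
    (fun x => (ContinuousLinearMap.single ℝ (fun _ : Fin 3 => ℂ) i).comp (fderiv ℝ g x))
    ∅ Set.countable_empty
    ((ContinuousLinearMap.single ℝ (fun _ : Fin 3 => ℂ) i).continuous.comp
      hg.continuous).continuousOn
    (fun x _ => (ContinuousLinearMap.single ℝ (fun _ : Fin 3 => ℂ) i).hasFDerivAt.comp x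
      (hg.differentiable one_ne_zero x).hasFDerivAt)
  have hs : ∀ x, ∑ j, ((ContinuousLinearMap.single ℝ (fun _ : Fin 3 => ℂ) i).comp
      (fderiv ℝ g x)) (Pi.single j 1) j = fderiv ℝ g x (Pi.single i 1) := by
    intro x
    rw [Finset.sum_eq_single i]
    · simp
    · intro j _ hj
      simp [hj]
    · simp
  simp only [hs] at key
  rw [key (hd.continuousOn.integrableOn_compact isCompact_Icc)]
  refine Finset.sum_eq_zero fun j _ => ?_
  rw [sub_eq_zero]
  congr 1
  ext y
  have : (j.insertNth (N : ℝ) y : V3) =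
      (j.insertNth (0 : ℝ) y : V3) + fun l => (N : ℝ) * ((Pi.single j 1 : Fin 3 → ℤ) l : ℝ) := by
    ext l
    refine Fin.succAboveCases j ?_ (fun l => ?_) l
    · simp
    · simp [Fin.succAbove_ne]
  simp only [Pi.zero_apply]
  rw [this, hp]

lemma fCoeffR_eq (N : ℕ) (f : V3 → ℝ) (ξ : V3) :
    fCoeffR N f ξ = ∫ x in cubeN N, ec ξ x * ((f x : ℝ) : ℂ) := rfl

lemma fCoeffR_neg (N : ℕ) (f : V3 → ℝ) (ξ : V3) :
    fCoeffR N f (-ξ) = (starRingEnd ℂ) (fCoeffR N f ξ) := by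
  rw [fCoeffR_eq, fCoeffR_eq, ← integral_conj]
  simp [ec_neg_left]

/-- The Bessel inequality. -/
lemma bessel (N : ℕ) (hN : 0 < N) (f : V3 → ℝ) (hf : Continuous f) :
    Summable fun k : Fin 3 → ℤ => Complex.normSq (fCoeffR N f (xiN N k)) := by
  have hN' : (0 : ℝ) < N := by exact_mod_cast hN
  set μ : Measure V3 := volume.restrict (cubeN N) with hμ
  have : IsFiniteMeasure μ := ⟨by rw [hμ, Measure.restrict_apply_univ]; exact cubeN_fin N⟩
  have hmem : ∀ g : V3 → ℂ, Continuous g → MemLp g 2 μ := by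
    intro g hg
    obtain ⟨C, hC⟩ := isCompact_Icc (a := (0 : V3)) (b := fun _ => (N : ℝ))
      |>.exists_bound_of_continuousOn hg.continuousOn
    refine MemLp.of_bound hg.aestronglyMeasurable C ?_
    filter_upwards [ae_restrict_mem (cubeN_meas N)] with x hx
    exact hC x (cubeN_sub N hx)
  have hinner : ∀ (g h : V3 → ℂ) (hg : Continuous g) (hh : Continuous h),
      inner ℂ ((hmem g hg).toLp g) ((hmem h hh).toLp h) =
        ∫ x in cubeN N, (starRingEnd ℂ) (g x) * h x := by
    intro g h hg hh
    rw [L2.inner_def]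
    refine integral_congr_ae ?_
    filter_upwards [(hmem g hg).coeFn_toLp, (hmem h hh).coeFn_toLp] with x h1 h2
    rw [h1, h2, RCLike.inner_apply, mul_comm]
  set c : ℝ := (Real.sqrt ((N : ℝ) ^ 3))⁻¹ with hc
  have hcpos : 0 < c := by positivity
  have hcc : c * c * (N : ℝ) ^ 3 = 1 := by
    have : Real.sqrt ((N : ℝ) ^ 3) * Real.sqrt ((N : ℝ) ^ 3) = (N : ℝ) ^ 3 :=
      Real.mul_self_sqrt (by positivity)
    rw [hc, ← mul_inv, this]
    exact inv_mul_cancel₀ (by positivity)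
  have hcont : ∀ k : Fin 3 → ℤ, Continuous fun x => (c : ℂ) * ec (xiN N (-k)) x :=
    fun k => continuous_const.mul (ec_cont _)
  have hfc : Continuous fun x => ((f x : ℝ) : ℂ) := Complex.continuous_ofReal.comp hf
  have hon : Orthonormal ℂ fun k : Fin 3 → ℤ => (hmem _ (hcont k)).toLp _ := by
    rw [orthonormal_iff_ite]
    intro k l
    rw [hinner _ _ (hcont k) (hcont l)]
    have : ∀ x, (starRingEnd ℂ) ((c : ℂ) * ec (xiN N (-k)) x) * ((c : ℂ) * ec (xiN N (-l)) x)
        = (c : ℂ) * c * ec (xiN N (k - l)) x := by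
      intro x
      rw [map_mul, Complex.conj_ofReal, xiN_neg N k, ec_neg_left, Complex.conj_conj,
        sub_eq_add_neg, xiN_add, ec_add_left]
      ring
    simp only [this]
    rw [integral_const_mul, ec_integral N hN]
    simp only [sub_eq_zero]
    split_ifs
    · exact_mod_cast hcc
    · simp
  have hs := hon.inner_products_summable ((hmem _ hfc).toLp _)
  simp only [fun k => hinner _ _ (hcont k) hfc] at hs
  have : ∀ k : Fin 3 → ℤ, ‖∫ x in cubeN N, (starRingEnd ℂ) ((c : ℂ) * ec (xiN N (-k)) x) *
      ((f x : ℝ) : ℂ)‖ ^ 2 = c ^ 2 * Complex.normSq (fCoeffR N f (xiN N k)) := by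
    intro k
    have : ∀ x, (starRingEnd ℂ) ((c : ℂ) * ec (xiN N (-k)) x) * ((f x : ℝ) : ℂ)
        = (c : ℂ) * (ec (xiN N k) x * ((f x : ℝ) : ℂ)) := by
      intro x
      rw [map_mul, Complex.conj_ofReal, xiN_neg N k, ec_neg_left, Complex.conj_conj]
      ring
    simp only [this]
    rw [integral_const_mul, ← fCoeffR_eq, norm_mul, mul_pow, Complex.normSq_eq_norm_sq]
    simp
  simp only [this] at hs
  exact (summable_mul_left_iff (by positivity)).1 hs

lemma xi_shift (N : ℕ) (hN : 0 < N) (k m : Fin 3 → ℤ) :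
    (fun i => xiN N k i + 2 * π * (m i : ℝ)) = xiN N (k + (N : ℤ) • m) := by
  have hN' : (N : ℝ) ≠ 0 := by exact_mod_cast hN.ne'
  ext i
  simp [xiN]
  field_simp

/-- The vanishing of `Σ(θ)v` kills every `(ξ·v) σ̂(ξ)`. -/
lemma ker_term (N : ℕ) (hN : 0 < N) (σ : V3 → ℝ) (hσ : Continuous σ)
    (k0 : Fin 3 → ℤ) (hk0 : ¬ inGamma1 N k0)
    (v : V3) (hker : (SigMat N σ (xiN N k0)).mulVec v = 0) (m : Fin 3 → ℤ) :
    (dotP (xiN N (k0 + (N : ℤ) • m)) v : ℂ) * fCoeffR N σ (xiN N (k0 + (N : ℤ) • m)) = 0 := by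
  have hN' : (0 : ℝ) < N := by exact_mod_cast hN
  set X : (Fin 3 → ℤ) → V3 := fun m => xiN N (k0 + (N : ℤ) • m) with hX
  set S : (Fin 3 → ℤ) → ℝ := fun m => Complex.normSq (fCoeffR N σ (X m)) with hS
  have hSsum : Summable S := by
    refine (bessel N hN σ hσ).comp_injective (i := fun m : Fin 3 → ℤ => k0 + (N : ℤ) • m) ?_
    intro a b hab
    have hab' : (N : ℤ) • a = (N : ℤ) • b := add_left_cancel hab
    have : (N : ℤ) ≠ 0 := by exact_mod_cast hN.ne'
    exact smul_right_injective _ this hab'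
  have hnn : ∀ m, 0 ≤ nsqV (X m) := fun m => Finset.sum_nonneg fun i _ => sq_nonneg _
  have hterm : ∀ a b, Summable fun m => X m a * X m b / nsqV (X m) * S m := by
    intro a b
    refine Summable.of_norm_bounded hSsum fun m => ?_
    have hSm : 0 ≤ S m := Complex.normSq_nonneg _
    rw [norm_mul, Real.norm_of_nonneg hSm]
    refine mul_le_of_le_one_left hSm ?_
    rw [norm_div, Real.norm_of_nonneg (hnn m)]
    refine div_le_one_of_le₀ ?_ (hnn m)
    rw [Real.norm_eq_abs, abs_le]
    have ha : (X m a) ^ 2 ≤ nsqV (X m) :=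
      Finset.single_le_sum (f := fun i => (X m i) ^ 2) (fun i _ => sq_nonneg _) (Finset.mem_univ a)
    have hb : (X m b) ^ 2 ≤ nsqV (X m) :=
      Finset.single_le_sum (f := fun i => (X m i) ^ 2) (fun i _ => sq_nonneg _) (Finset.mem_univ b)
    constructor <;> nlinarith [sq_nonneg (X m a + X m b), sq_nonneg (X m a - X m b)]
  have hentry : ∀ a b, HasSum (fun m => X m a * X m b / nsqV (X m) * S m)
      (SigMat N σ (xiN N k0) a b) := by
    intro a b
    have : SigMat N σ (xiN N k0) a b = ∑' m, X m a * X m b / nsqV (X m) * S m := by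
      simp only [SigMat, Matrix.of_apply, hX, hS, ← xi_shift N hN]
    rw [this]
    exact (hterm a b).hasSum
  have hq : HasSum (fun m => ∑ a, v a * ∑ b, (X m a * X m b / nsqV (X m) * S m) * v b)
      (∑ a, v a * ∑ b, SigMat N σ (xiN N k0) a b * v b) :=
    hasSum_sum fun a _ => (hasSum_sum fun b _ => (hentry a b).mul_right _).mul_left _
  have h0 : (∑ a, v a * ∑ b, SigMat N σ (xiN N k0) a b * v b) = 0 := by
    refine Finset.sum_eq_zero fun a _ => ?_
    have : ∑ b, SigMat N σ (xiN N k0) a b * v b = 0 := congrFun hker a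
    rw [this, mul_zero]
  rw [h0] at hq
  have hform : ∀ m, ∑ a, v a * ∑ b, (X m a * X m b / nsqV (X m) * S m) * v b
      = (dotP (X m) v) ^ 2 / nsqV (X m) * S m := by
    intro m
    simp only [dotP, Fin.sum_univ_three]
    ring
  simp only [hform] at hq
  have hz := (hasSum_zero_iff_of_nonneg (fun m => by
    have := hnn m
    have hSm : 0 ≤ S m := Complex.normSq_nonneg _
    positivity)).1 hq
  have hzm := congrFun hz m
  simp only [Pi.zero_apply] at hzm
  have hXm : nsqV (X m) ≠ 0 := by
    intro h
    apply hk0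
    intro i
    have h1 := (Finset.sum_eq_zero_iff_of_nonneg (fun i _ => sq_nonneg (X m i))).1 h i
      (Finset.mem_univ i)
    have h2 : X m i = 0 := by simpa using h1
    simp only [hX, xiN] at h2
    have h3 : 2 * π / (N : ℝ) ≠ 0 := by positivity
    have h4 : (((k0 + (N : ℤ) • m) i : ℤ) : ℝ) = 0 := (mul_eq_zero.1 h2).resolve_left h3
    have h5 : k0 i + (N : ℤ) * m i = 0 := by exact_mod_cast h4
    exact ⟨- m i, by linarith⟩
  rcases mul_eq_zero.1 hzm with h | h
  · have : dotP (X m) v = 0 := by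
      rcases div_eq_zero_iff.1 h with h | h
      · simpa using h
      · exact absurd h hXm
    change ((dotP (X m) v : ℝ) : ℂ) * fCoeffR N σ (X m) = 0
    rw [this]; simp
  · have : fCoeffR N σ (X m) = 0 := by simpa [hS] using h
    change ((dotP (X m) v : ℝ) : ℂ) * fCoeffR N σ (X m) = 0
    rw [this]; simp

lemma ec_sum (N : ℕ) (hN : 0 < N) (k : Fin 3 → ℤ) (hk : ¬ inGamma1 N k) :
    ∑ n : GammaIdx N, ec (xiN N k) (embG n) = 0 := by
  have hN' : (N : ℂ) ≠ 0 := by exact_mod_cast hN.ne'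
  set z : Fin 3 → ℂ := fun i => Complex.exp (Complex.I * (2 * π / N * k i)) with hz
  have h1 : ∀ n : GammaIdx N, ec (xiN N k) (embG n) = ∏ i, z i ^ (n i : ℕ) := by
    intro n
    simp only [ec, dotP, hz, ← Complex.exp_nat_mul]
    rw [← Complex.exp_sum]
    congr 1
    push_cast
    rw [Finset.mul_sum]
    refine Finset.sum_congr rfl fun i _ => ?_
    simp [xiN, embG]
    ring
  simp only [h1]
  have h2 := Finset.prod_univ_sum (fun _ : Fin 3 => (Finset.univ : Finset (Fin N)))
    (fun i j => z i ^ (j : ℕ))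
  rw [Fintype.piFinset_univ] at h2
  rw [← h2]
  unfold inGamma1 at hk
  push Not at hk
  obtain ⟨i, hi⟩ := hk
  refine Finset.prod_eq_zero (Finset.mem_univ i) ?_
  rw [Fin.sum_univ_eq_sum_range (fun j => z i ^ j) N]
  have hz1 : z i ≠ 1 := by
    intro h
    rw [hz] at h
    obtain ⟨n, hn⟩ := Complex.exp_eq_one_iff.1 h
    apply hi
    refine ⟨n, ?_⟩
    have hpi : (π : ℂ) ≠ 0 := by exact_mod_cast Real.pi_ne_zero
    field_simp at hn
    have : (k i : ℂ) = N * n := by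
      linear_combination hn
    exact_mod_cast this
  have hzN : z i ^ N = 1 := by
    rw [hz]
    simp only
    rw [← Complex.exp_nat_mul, Complex.exp_eq_one_iff]
    refine ⟨k i, ?_⟩
    field_simp
  rw [geom_sum_eq hz1, hzN]
  simp

lemma gradV_per (N : ℕ) (σ : V3 → ℝ) (hp : IsPerN N σ) : IsPerN N (gradV σ) := by
  intro x k
  have h : (fun y => σ (y + fun i => (N : ℝ) * (k i : ℝ))) = σ := funext fun y => hp y k
  have h2 := fderiv_comp_add_right (𝕜 := ℝ) (f := σ) (x := x) (fun i => (N : ℝ) * (k i : ℝ))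
  rw [h] at h2
  ext i
  simp only [gradV, h2]

lemma gradV_cont (σ : V3 → ℝ) (hreg : ContDiff ℝ 2 σ) (i : Fin 3) :
    Continuous fun x => gradV σ x i :=
  (hreg.continuous_fderiv two_ne_zero).clm_apply continuous_const

lemma fCoeff_grad (N : ℕ) (hN : 0 < N) (σ : V3 → ℝ) (hp : IsPerN N σ) (hreg : ContDiff ℝ 2 σ)
    (k : Fin 3 → ℤ) (i : Fin 3) :
    ∫ x in cubeN N, ec (xiN N k) x * ((gradV σ x i : ℝ) : ℂ)
      = -(Complex.I * (xiN N k i : ℂ) * fCoeffR N σ (xiN N k)) := by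
  set ξ := xiN N k with hξ
  have hσc : ContDiff ℝ 2 fun x => ((σ x : ℝ) : ℂ) := Complex.ofRealCLM.contDiff.comp hreg
  have hg : ContDiff ℝ 1 fun x => ec ξ x * ((σ x : ℝ) : ℂ) :=
    ((ec_contDiff ξ).mul hσc).of_le (by norm_num)
  have hgp : IsPerN N fun x => ec ξ x * ((σ x : ℝ) : ℂ) := by
    intro x m
    simp only [hp x m, hξ, ec_per N hN k x m]
  have h0 := int_deriv_zero N _ hg hgp i
  have hec : ∀ x, HasFDerivAt (ec ξ)
      (ec ξ x • (Complex.I • (Complex.ofRealCLM.comp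
        (∑ j, ξ j • (ContinuousLinearMap.proj j : V3 →L[ℝ] ℝ))))) x := by
    intro x
    have hl : HasFDerivAt (fun y : V3 => dotP ξ y)
        (∑ j, ξ j • (ContinuousLinearMap.proj j : V3 →L[ℝ] ℝ)) x := by
      have : (fun y : V3 => dotP ξ y) =
          ⇑(∑ j, ξ j • (ContinuousLinearMap.proj j : V3 →L[ℝ] ℝ)) := by
        ext y; simp [dotP]
      rw [this]
      exact ContinuousLinearMap.hasFDerivAt _
    have h2 : HasFDerivAt (fun y : V3 => ((dotP ξ y : ℝ) : ℂ)) _ x :=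
      Complex.ofRealCLM.hasFDerivAt.comp x hl
    exact (h2.const_mul Complex.I).cexp
  have hd : ∀ x, fderiv ℝ (fun x => ec ξ x * ((σ x : ℝ) : ℂ)) x (Pi.single i 1)
      = ec ξ x * ((gradV σ x i : ℝ) : ℂ) + Complex.I * (ξ i : ℂ) * (ec ξ x * ((σ x : ℝ) : ℂ)) := by
    intro x
    have hs : HasFDerivAt (fun y : V3 => ((σ y : ℝ) : ℂ)) _ x :=
      Complex.ofRealCLM.hasFDerivAt.comp x (hreg.differentiable two_ne_zero x).hasFDerivAt
    have h3 : HasFDerivAt (fun x => ec ξ x * ((σ x : ℝ) : ℂ)) _ x := (hec x).mul hs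
    rw [h3.fderiv]
    simp [gradV, Pi.single_apply]
    ring
  simp only [hd] at h0
  rw [integral_add, integral_const_mul, ← fCoeffR_eq N σ] at h0
  · linear_combination h0
  · exact cont_intOn N _ ((ec_cont ξ).mul (Complex.continuous_ofReal.comp (gradV_cont σ hreg i)))
  · exact cont_intOn N _ (continuous_const.mul hg.continuous)

lemma fCoeff_shift (N : ℕ) (hN : 0 < N) (h : V3 → ℂ) (hp : IsPerN N h)
    (k : Fin 3 → ℤ) (a : V3) :
    ∫ x in cubeN N, ec (xiN N k) x * h (x - a)
      = ec (xiN N k) a * ∫ x in cubeN N, ec (xiN N k) x * h x := by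
  have hper : IsPerN N fun x => ec (xiN N k) x * h (x - a) := by
    intro x m
    simp only [ec_per N hN k x m]
    rw [add_sub_right_comm, hp]
  rw [← int_shift N hN _ hper a, ← integral_const_mul]
  simp only [ec_add_right, add_sub_cancel_left, mul_assoc]

lemma fCoeff_sigma1 (N : ℕ) (hN : 0 < N) (σ : V3 → ℝ) (hp : IsPerN N σ)
    (hreg : ContDiff ℝ 2 σ) (r v : V3) (c : GammaIdx N → ℝ) (k : Fin 3 → ℤ) :
    fCoeffR N (sigma1F N σ r (fun n => c n • v)) (xiN N k)
      = Complex.I * ec (xiN N k) r * (∑ n, ec (xiN N k) (embG n) * (c n : ℂ))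
        * ((dotP (xiN N k) v : ℂ) * fCoeffR N σ (xiN N k)) := by
  set ξ := xiN N k with hξ
  set D : V3 → ℂ := fun y => ∑ i, (v i : ℂ) * ((gradV σ y i : ℝ) : ℂ) with hD
  have hDc : Continuous D := continuous_finsetSum _ fun i _ =>
    continuous_const.mul (Complex.continuous_ofReal.comp (gradV_cont σ hreg i))
  have hDp : IsPerN N D := by
    intro x m
    simp only [hD, gradV_per N σ hp x m]
  have hDint : ∫ x in cubeN N, ec ξ x * D x
      = -(Complex.I * ((dotP ξ v : ℂ) * fCoeffR N σ ξ)) := by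
    simp only [hD, Finset.mul_sum]
    rw [integral_finsetSum]
    · have : ∀ i, ∫ x in cubeN N, ec ξ x * ((v i : ℂ) * ((gradV σ x i : ℝ) : ℂ))
          = (v i : ℂ) * -(Complex.I * (ξ i : ℂ) * fCoeffR N σ ξ) := by
        intro i
        rw [hξ, ← fCoeff_grad N hN σ hp hreg k i, ← integral_const_mul]
        congr 1
        ext x
        ring
      simp only [this, dotP, Fin.sum_univ_three]
      push_cast
      ring
    · intro i _
      exact cont_intOn N _ ((ec_cont ξ).mul (continuous_const.mul
        (Complex.continuous_ofReal.comp (gradV_cont σ hreg i))))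
  have hs : ∀ x, ec ξ x * ((sigma1F N σ r (fun n => c n • v) x : ℝ) : ℂ)
      = ∑ n, (-(c n : ℂ)) * (ec ξ x * D (x - (embG n + r))) := by
    intro x
    simp only [sigma1F, hD, dotP, Fin.sum_univ_three, sub_add_eq_sub_sub]
    push_cast
    rw [← Finset.sum_neg_distrib, Finset.mul_sum]
    refine Finset.sum_congr rfl fun n _ => ?_
    simp
    ring
  rw [fCoeffR_eq]
  simp only [hs]
  rw [integral_finsetSum]
  · simp only [integral_const_mul, hξ]
    simp only [fCoeff_shift N hN D hDp k]
    rw [← hξ, hDint]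
    rw [Finset.mul_sum, Finset.sum_mul]
    refine Finset.sum_congr rfl fun n _ => ?_
    rw [ec_add_right]
    ring
  · intro n _
    exact cont_intOn N _ (continuous_const.mul ((ec_cont ξ).mul
      (hDc.comp (continuous_id.sub continuous_const))))

lemma ec_cos (θ x : V3) : ((Real.cos (dotP θ x) : ℝ) : ℂ) = (ec θ x + ec (-θ) x) / 2 := by
  rw [Complex.ofReal_cos, Complex.cos, ec, ec, dotP_neg_left]
  push_cast
  ring_nf

lemma cos_sum (N : ℕ) (hN : 0 < N) (k k0 : Fin 3 → ℤ) (h1 : ¬ inGamma1 N (k + k0))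
    (h2 : ¬ inGamma1 N (k - k0)) :
    ∑ n : GammaIdx N, ec (xiN N k) (embG n) *
      ((Real.cos (dotP (xiN N k0) (embG n)) : ℝ) : ℂ) = 0 := by
  have : ∀ n : GammaIdx N, ec (xiN N k) (embG n) *
      ((Real.cos (dotP (xiN N k0) (embG n)) : ℝ) : ℂ)
      = (ec (xiN N (k + k0)) (embG n) + ec (xiN N (k - k0)) (embG n)) / 2 := by
    intro n
    rw [ec_cos, sub_eq_add_neg, xiN_add, xiN_add, xiN_neg, ec_add_left, ec_add_left]
    ring
  simp only [this]
  rw [← Finset.sum_div, Finset.sum_add_distrib, ec_sum N hN _ h1, ec_sum N hN _ h2]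
  simp

/-- necessity of the Wiener condition for positivity of the Hessian. -/
theorem stmt10 (N : ℕ) (hN : 0 < N) (σ : V3 → ℝ) (e Z M : ℝ)
    (he : 0 < e) (hZ : 0 < Z) (hM : 0 < M)
    (hper : IsPerN N σ) (hreg : ContDiff ℝ 2 σ)
    (hint : (∫ x in cubeN N, σ x) = e * Z)
    (hJ : JelliumCond N σ)
    (k0 : Fin 3 → ℤ) (hk0 : ¬ inGamma1 N k0)
    (v : V3) (hv : v ≠ 0) (hker : (SigMat N σ (xiN N k0)).mulVec v = 0) :
    ∀ (α : ℝ) (r : V3), ∃ κ : GammaIdx N → V3,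
      (¬ ∀ n : GammaIdx N, κ n = 0) ∧ (∑ n : GammaIdx N, κ n) = 0 ∧
        BformQ N σ e Z M α r (fun _ => 0) κ (fun _ => 0) = 0 := by

  intro α r
  set κ : GammaIdx N → V3 := fun n => Real.cos (dotP (xiN N k0) (embG n)) • v with hκ
  refine ⟨κ, ?_, ?_, ?_⟩
  · intro h
    have h0 := h (fun _ => ⟨0, hN⟩)
    have hz : embG (fun _ => ⟨0, hN⟩ : GammaIdx N) = 0 := by
      ext i; simp [embG]
    simp only [hκ, hz] at h0
    apply hv
    simpa [dotP] using h0
  · simp only [hκ]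
    rw [← Finset.sum_smul]
    have hneg : ¬ inGamma1 N (0 - k0) := by
      intro h
      apply hk0
      intro i
      have := h i
      simpa using this
    have h1 := cos_sum N hN 0 k0 (by simpa using hk0) hneg
    simp only [xiN_zero, ec_zero_left, one_mul] at h1
    have h2 : ∑ n : GammaIdx N, Real.cos (dotP (xiN N k0) (embG n)) = 0 := by
      exact_mod_cast h1
    rw [h2, zero_smul]
  · have hcoef : ∀ k, fCoeffR N (sigma1F N σ r κ) (xiN N k) = 0 := by
      intro k
      rw [hκ, fCoeff_sigma1 N hN σ hper hreg r v]
      by_cases h2 : inGamma1 N (k - k0)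
      · choose m hm using h2
        have hk : k = k0 + (N : ℤ) • m := by
          ext i
          have := hm i
          simp only [Pi.sub_apply] at this
          simp only [Pi.add_apply, Pi.smul_apply, smul_eq_mul]
          linarith
        have := ker_term N hN σ hreg.continuous k0 hk0 v hker m
        rw [← hk] at this
        rw [this, mul_zero]
      · by_cases h1 : inGamma1 N (k + k0)
        · choose m hm using h1
          have hk : -k = k0 + (N : ℤ) • (-m) := by
            ext i
            have := hm i
            simp only [Pi.add_apply] at this
            simp only [Pi.add_apply, Pi.smul_apply, smul_eq_mul, Pi.neg_apply]
            linarith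
          have := ker_term N hN σ hreg.continuous k0 hk0 v hker (-m)
          rw [← hk, xiN_neg, dotP_neg_left, fCoeffR_neg] at this
          have h3 : ((dotP (xiN N k) v : ℝ) : ℂ) * fCoeffR N σ (xiN N k) = 0 := by
            rcases mul_eq_zero.1 this with h | h
            · have : dotP (xiN N k) v = 0 := by simpa using h
              rw [this]; simp
            · have : fCoeffR N σ (xiN N k) = 0 := by simpa using h
              rw [this]; simp
          rw [h3, mul_zero]
        · rw [cos_sum N hN k k0 h1 h2]
          simp
    have hrho : rho1F N σ e Z α r κ (fun _ => 0) = sigma1F N σ r κ := by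
      ext x; simp [rho1F]
    have hdual : dualSum N (rho1F N σ e Z α r κ (fun _ => 0)) = 0 := by
      simp [dualSum, hrho, hcoef]
    have hg : ∀ x, gradSq (fun _ : V3 => (0 : ℂ)) x = 0 := by
      intro x; simp [gradSq]
    simp [BformQ, hdual, hg, nsqV]

end SPN
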